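/- Let λ be a partition of d₁ with evaluation parameters a ∈ ℂ^{λ_1}, let μ be a partition of d₂ with evaluation parameters b ∈ ℂ^{μ_1}, and let (ν, c) be their concatenation, a partition of d = d₁ + d₂ with c ∈ ℂ^{ν_1}. Then the ℂ-algebra isomorphism κ : ℂ[t_1, …, t_d] → ℂ[t_1, …, t_{d₁}] ⊗_ℂ ℂ[t_1, …, t_{d₂}] determined by κ(t_i) = t_i ⊗ 1 for 1 ≤ i ≤ d₁ and κ(t_i) = 1 ⊗ t_{i−d₁} for d₁ < i ≤ d maps the deformed Tanisaki ideal ⟨𝒞^c_ν⟩ into the ideal ⟨𝒞^a_λ⟩ ⊗ ℂ[t_1, …, t_{d₂}] + ℂ[t_1, …, t_{d₁}] ⊗ ⟨𝒞^b_μ⟩, and hence κ induces a surjective homomorphism of ℂ-algebras R_c(ν) → R_a(λ) ⊗_ℂ R_b(μ). -/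

import Mathlib

open MvPolynomial

noncomputable section

/-- Complete homogeneous symmetric function `h_k` of a list of complex numbers. -/
def hcomp : ℕ → List ℂ → ℂ
  | 0, _ => 1
  | _ + 1, [] => 0
  | k + 1, x :: l => x * hcomp k (x :: l) + hcomp (k + 1) l
  termination_by k l => (l.length, k)

/-- Elementary symmetric polynomial `e_r` in the variables indexed by `J ⊆ {1,…,d}`. -/
def elemSym (d : ℕ) (J : Finset (Fin d)) (r : ℕ) : MvPolynomial (Fin d) ℂ :=
  ∑ s ∈ J.powersetCard r, ∏ j ∈ s, X j

/-- The tuple `a^{(n)}` : entries `a_1,…,a_{λ_i}` for each row `i = n+1,…,ℓ` (0-indexed rows). -/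
def aTuple (ℓ : ℕ) (lam : ℕ → ℕ) (a : ℕ → ℂ) (n : ℕ) : List ℂ :=
  ((List.range ℓ).drop n).flatMap fun i => (List.range (lam i)).map a

/-- `m_λ(n) = λ_{n+1} + … + λ_ℓ` (0-indexed rows `n,…,ℓ-1`). -/
def mRem (ℓ : ℕ) (lam : ℕ → ℕ) (n : ℕ) : ℕ := ∑ i ∈ Finset.Ico n ℓ, lam i

/-- The deformed Tanisaki generator `g_{n,J,r} = Σ_{k=0}^r (−1)^k e_{r−k}(t_J) h_k(a^{(n)})`. -/
def tanGen (d ℓ : ℕ) (lam : ℕ → ℕ) (a : ℕ → ℂ) (n : ℕ) (J : Finset (Fin d)) (r : ℕ) :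
    MvPolynomial (Fin d) ℂ :=
  ∑ k ∈ Finset.range (r + 1), C ((-1) ^ k * hcomp k (aTuple ℓ lam a n)) * elemSym d J (r - k)

/-- The deformed Tanisaki ideal `⟨𝒞^a_λ⟩`. -/
def tanIdeal (d ℓ : ℕ) (lam : ℕ → ℕ) (a : ℕ → ℂ) : Ideal (MvPolynomial (Fin d) ℂ) :=
  Ideal.span {g | ∃ n J r, n < ℓ ∧ J.card = d - n ∧
    d - n - mRem ℓ lam n < r ∧ r ≤ d - n ∧ g = tanGen d ℓ lam a n J r}

/-- `lam 0, lam 1, …, lam (ℓ-1)` is a partition of `d` with `ℓ` positive parts. -/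
def IsPartitionOf (d ℓ : ℕ) (lam : ℕ → ℕ) : Prop :=
  0 < ℓ ∧ (∀ i j, i ≤ j → lam j ≤ lam i) ∧ (∀ i < ℓ, 0 < lam i) ∧
    (∀ i, ℓ ≤ i → lam i = 0) ∧ ∑ i ∈ Finset.range ℓ, lam i = d

/-- `λ^t_i = #{rows j with λ_j ≥ i}` (here `i ≥ 1`). -/
def lamT (ℓ : ℕ) (lam : ℕ → ℕ) (i : ℕ) : ℕ :=
  ((Finset.range ℓ).filter fun j => i ≤ lam j).card

/-- The deformed Tanisaki–Garsia–Procesi algebra `R_a(λ)`. -/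
abbrev TGPAlg (d ℓ : ℕ) (lam : ℕ → ℕ) (a : ℕ → ℂ) :=
  MvPolynomial (Fin d) ℂ ⧸ tanIdeal d ℓ lam a


open TensorProduct in
/-- The algebra isomorphism `κ : ℂ[t_1,…,t_{d₁+d₂}] → ℂ[t_1,…,t_{d₁}] ⊗ ℂ[t_1,…,t_{d₂}]`,
`t_i ↦ t_i ⊗ 1` for `i ≤ d₁` and `t_i ↦ 1 ⊗ t_{i−d₁}` for `i > d₁`. -/
def kappa (d₁ d₂ : ℕ) : MvPolynomial (Fin (d₁ + d₂)) ℂ →ₐ[ℂ]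
    TensorProduct ℂ (MvPolynomial (Fin d₁) ℂ) (MvPolynomial (Fin d₂) ℂ) :=
  aeval fun i => if h : i.1 < d₁ then X ⟨i.1, h⟩ ⊗ₜ[ℂ] (1 : MvPolynomial (Fin d₂) ℂ)
    else (1 : MvPolynomial (Fin d₁) ℂ) ⊗ₜ[ℂ] X ⟨i.1 - d₁, by have := i.isLt; omega⟩

/-! ### Helper lemmas -/

/-- `∏ (1 + x z)` over a multiset. -/
def linProd (L : Multiset ℂ) : PowerSeries ℂ :=
  (L.map fun x => 1 + PowerSeries.C x * PowerSeries.X).prod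

/-- Generating series `∑ (-1)^k h_k z^k`. -/
def hSer (L : List ℂ) : PowerSeries ℂ := PowerSeries.mk fun k => (-1) ^ k * hcomp k L

/-- Generating series of elementary symmetric polynomials. -/
def eSer (d : ℕ) (J : Finset (Fin d)) : PowerSeries (MvPolynomial (Fin d) ℂ) :=
  ∏ j ∈ J, (1 + PowerSeries.C (X j) * PowerSeries.X)

theorem hSer_cons (x : ℂ) (l : List ℂ) :
    (1 + PowerSeries.C x * PowerSeries.X) * hSer (x :: l) = hSer l := by
  ext k
  cases k with
  | zero => simp [hSer, add_mul, mul_assoc, hcomp]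
  | succ k =>
    rw [add_mul, one_mul, mul_assoc, map_add, PowerSeries.coeff_C_mul,
      PowerSeries.coeff_succ_X_mul]
    simp only [hSer, PowerSeries.coeff_mk]
    rw [hcomp.eq_3]
    ring

theorem hSer_nil : hSer [] = 1 := by
  ext k
  cases k with
  | zero => simp [hSer, hcomp]
  | succ k => simp [hSer, hcomp, PowerSeries.coeff_one]

theorem linProd_mul_hSer (l : List ℂ) : linProd (l : Multiset ℂ) * hSer l = 1 := by
  induction l with
  | nil => simp [linProd, hSer_nil]
  | cons x l ih =>
    have : linProd ((x :: l : List ℂ) : Multiset ℂ) =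
        (1 + PowerSeries.C x * PowerSeries.X) * linProd (l : Multiset ℂ) := by
      simp [linProd]
    rw [this, mul_right_comm, hSer_cons, mul_comm, ih]

theorem coeff_eSer (d : ℕ) (J : Finset (Fin d)) (r : ℕ) :
    PowerSeries.coeff r (eSer d J) = elemSym d J r := by
  classical
  unfold eSer elemSym
  rw [Finset.prod_one_add, map_sum, Finset.powersetCard_eq_filter, Finset.sum_filter]
  refine Finset.sum_congr rfl fun s _ => ?_
  rw [Finset.prod_mul_distrib, Finset.prod_const, ← map_prod, PowerSeries.coeff_C_mul,
    PowerSeries.coeff_X_pow]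
  by_cases h : s.card = r
  · simp [h]
  · simp [h, Ne.symm h]

theorem tanGen_eq (d ℓ : ℕ) (lam : ℕ → ℕ) (a : ℕ → ℂ) (n : ℕ) (J : Finset (Fin d)) (r : ℕ) :
    tanGen d ℓ lam a n J r = PowerSeries.coeff r
      (PowerSeries.map C (hSer (aTuple ℓ lam a n)) * eSer d J) := by
  rw [PowerSeries.coeff_mul, Finset.Nat.sum_antidiagonal_eq_sum_range_succ_mk]
  simp [tanGen, hSer, coeff_eSer]

/-- Coefficients in degrees `> N` lie in `I`. -/
def Bd {S : Type*} [CommRing S] (I : Ideal S) (P : PowerSeries S) (N : ℕ) : Prop :=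
  ∀ r, N < r → PowerSeries.coeff r P ∈ I

theorem Bd.mul {S : Type*} [CommRing S] {I : Ideal S} {P Q : PowerSeries S} {N M : ℕ}
    (hP : Bd I P N) (hQ : Bd I Q M) : Bd I (P * Q) (N + M) := by
  intro r hr
  rw [PowerSeries.coeff_mul]
  refine Ideal.sum_mem _ fun p hp => ?_
  rw [Finset.HasAntidiagonal.mem_antidiagonal] at hp
  by_cases h : N < p.1
  · exact Ideal.mul_mem_right _ _ (hP _ h)
  · exact Ideal.mul_mem_left _ _ (hQ _ (by omega))

theorem Bd.map {S T : Type*} [CommRing S] [CommRing T] {I : Ideal S} {K : Ideal T}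
    {P : PowerSeries S} {N : ℕ} (f : S →+* T) (hf : ∀ x ∈ I, f x ∈ K)
    (hP : Bd I P N) : Bd K (PowerSeries.map f P) N := by
  intro r hr
  rw [PowerSeries.coeff_map]
  exact hf _ (hP r hr)

theorem bd_linear {S : Type*} [CommRing S] (I : Ideal S) (x : S) :
    Bd I (1 + PowerSeries.C x * PowerSeries.X) 1 := by
  intro r hr
  obtain ⟨r, rfl⟩ : ∃ k, r = k + 2 := ⟨r - 2, by omega⟩
  have : PowerSeries.coeff (r + 2) (1 + PowerSeries.C x * PowerSeries.X) = 0 := by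
    rw [map_add, PowerSeries.coeff_C_mul, PowerSeries.coeff_X, PowerSeries.coeff_one]
    simp
  rw [this]; exact I.zero_mem

theorem bd_one {S : Type*} [CommRing S] (I : Ideal S) : Bd I (1 : PowerSeries S) 0 := by
  intro r hr
  rw [PowerSeries.coeff_one, if_neg (by omega)]; exact I.zero_mem

theorem bd_linProd (L : Multiset ℂ) : Bd ⊥ (linProd L) L.card := by
  induction L using Multiset.induction with
  | empty => simpa [linProd] using bd_one (⊥ : Ideal ℂ)
  | cons x L ih =>
    have : linProd (x ::ₘ L) = linProd L * (1 + PowerSeries.C x * PowerSeries.X) := by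
      simp [linProd, mul_comm]
    rw [this, Multiset.card_cons]
    exact ih.mul (bd_linear _ x)

theorem bd_eSer (d : ℕ) (J : Finset (Fin d)) (I : Ideal (MvPolynomial (Fin d) ℂ)) :
    Bd I (eSer d J) J.card := by
  classical
  unfold eSer
  induction J using Finset.induction with
  | empty => simpa using bd_one I
  | insert x L hx ih =>
    rw [Finset.prod_insert hx, Finset.card_insert_of_notMem hx, mul_comm]
    exact ih.mul (bd_linear _ _)

theorem coeff_zero_linProd (L : Multiset ℂ) : PowerSeries.coeff 0 (linProd L) = 1 := by
  rw [PowerSeries.coeff_zero_eq_constantCoeff_apply, linProd, map_multiset_prod]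
  simp

/-- If `P * A` has bounded degree, and coefficients of `P` vanish in a window, they vanish after. -/
theorem bd_of_window {S : Type*} [CommRing S] (I : Ideal S) (P A : PowerSeries S) (D m : ℕ)
    (hm : m ≤ D) (hA0 : PowerSeries.coeff 0 A = 1) (hA : Bd I A m) (hPA : Bd I (P * A) D)
    (hw : ∀ r, D - m < r → r ≤ D → PowerSeries.coeff r P ∈ I) : Bd I P (D - m) := by
  intro r
  induction r using Nat.strong_induction_on with
  | _ r ih =>
    intro hr
    by_cases hrD : r ≤ D
    · exact hw r hr hrD
    · have h1 := hPA r (by omega)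
      rw [PowerSeries.coeff_mul, ← Finset.add_sum_erase _ _
        (show (r, 0) ∈ Finset.HasAntidiagonal.antidiagonal r by simp)] at h1
      simp only [hA0, mul_one] at h1
      refine (Ideal.add_mem_iff_left _ ?_).mp h1
      refine Ideal.sum_mem _ fun p hp => ?_
      rw [Finset.mem_erase, Finset.HasAntidiagonal.mem_antidiagonal] at hp
      obtain ⟨hp0, hp⟩ := hp
      have hp2 : p.2 ≠ 0 := by
        intro h
        apply hp0
        ext <;> simp <;> omega
      by_cases h : m < p.2
      · exact Ideal.mul_mem_left _ _ (hA _ h)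
      · exact Ideal.mul_mem_right _ _ (ih _ (by omega) (by omega))

theorem aTuple_eq (ℓ : ℕ) (lam : ℕ → ℕ) (a : ℕ → ℂ) (n : ℕ) :
    ((aTuple ℓ lam a n : List ℂ) : Multiset ℂ) =
      ∑ i ∈ Finset.Ico n ℓ, ∑ j ∈ Finset.range (lam i), {a j} := by
  have h1 : ∀ k : ℕ, (((List.range k).map a : List ℂ) : Multiset ℂ) =
      ∑ j ∈ Finset.range k, {a j} := by
    intro k
    induction k with
    | zero => simp
    | succ k ih =>
      rw [Finset.sum_range_succ, ← ih, List.range_succ, List.map_append, ← Multiset.coe_add]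
      rfl
  have h2 : ∀ L : List ℕ, ((L.flatMap fun i => (List.range (lam i)).map a : List ℂ) :
      Multiset ℂ) = (L.map fun i => ∑ j ∈ Finset.range (lam i), ({a j} : Multiset ℂ)).sum := by
    intro L
    induction L with
    | nil => simp
    | cons x L ih =>
      rw [List.flatMap_cons, ← Multiset.coe_add, ih, h1, List.map_cons, List.sum_cons]
  have h3 : (List.range ℓ).drop n = List.range' n (ℓ - n) := by
    rw [List.range_eq_range', List.drop_range']
    simp
  unfold aTuple
  rw [h2, h3]
  rfl

theorem card_aTuple (ℓ : ℕ) (lam : ℕ → ℕ) (a : ℕ → ℂ) (n : ℕ) :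
    Multiset.card ((aTuple ℓ lam a n : List ℂ) : Multiset ℂ) = mRem ℓ lam n := by
  rw [aTuple_eq, mRem]
  simp

theorem card_filter_Ico (d ℓ : ℕ) (lam : ℕ → ℕ) (h : IsPartitionOf d ℓ lam) (n j : ℕ) :
    ((Finset.Ico n ℓ).filter fun i => j < lam i).card = lamT ℓ lam (j + 1) - n := by
  unfold lamT
  obtain ⟨-, hmono, -⟩ := h
  by_cases hex : ∃ i, n ≤ i ∧ i < ℓ ∧ j < lam i
  · obtain ⟨i, hi, hil, hj⟩ := hex
    have : (Finset.range ℓ).filter (fun i => j + 1 ≤ lam i) =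
        Finset.range n ∪ (Finset.Ico n ℓ).filter fun i => j < lam i := by
      ext k
      simp only [Finset.mem_filter, Finset.mem_range, Finset.mem_union, Finset.mem_Ico]
      constructor
      · intro h; omega
      · rintro (h | h)
        · have := hmono k i (by omega); omega
        · omega
    rw [this, Finset.card_union_of_disjoint, Finset.card_range]
    · omega
    · rw [Finset.disjoint_left]; intro k; simp; omega
  · push Not at hex
    rw [Finset.filter_eq_empty_iff.mpr, Finset.card_empty]
    · symm
      rw [Nat.sub_eq_zero_iff_le]
      calc _ ≤ (Finset.range n).card := Finset.card_le_card (by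
            intro k; simp only [Finset.mem_filter, Finset.mem_range]
            intro hk
            by_contra hcon
            have := hex k (by omega) hk.1
            omega)
        _ = n := by simp
    · intro k hk; rw [Finset.mem_Ico] at hk
      have := hex k hk.1 hk.2; omega

theorem aTuple_eq' (d ℓ : ℕ) (lam : ℕ → ℕ) (h : IsPartitionOf d ℓ lam) (a : ℕ → ℂ) (n : ℕ) :
    ((aTuple ℓ lam a n : List ℂ) : Multiset ℂ) =
      ∑ j : Fin (lam 0), (lamT ℓ lam (j.1 + 1) - n) • ({a j.1} : Multiset ℂ) := by
  rw [aTuple_eq, Fin.sum_univ_eq_sum_range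
    (fun j => (lamT ℓ lam (j + 1) - n) • ({a j} : Multiset ℂ)) (lam 0)]
  have : ∀ i ∈ Finset.Ico n ℓ, (∑ j ∈ Finset.range (lam i), ({a j} : Multiset ℂ)) =
      ∑ j ∈ Finset.range (lam 0), if j < lam i then ({a j} : Multiset ℂ) else 0 := by
    intro i _
    rw [← Finset.sum_filter]
    congr 1
    ext j
    have := h.2.1 0 i (by omega)
    simp; omega
  rw [Finset.sum_congr rfl this, Finset.sum_comm]
  refine Finset.sum_congr rfl fun j _ => ?_
  rw [← Finset.sum_filter, Finset.sum_const, card_filter_Ico d ℓ lam h]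

theorem mRem_le (d ℓ : ℕ) (lam : ℕ → ℕ) (h : IsPartitionOf d ℓ lam) (n : ℕ) (hn : n ≤ ℓ) :
    mRem ℓ lam n + n ≤ d := by
  obtain ⟨-, -, hpos, -, hs⟩ := h
  rw [← hs, mRem, Finset.range_eq_Ico, ← Finset.sum_Ico_consecutive lam (Nat.zero_le n) hn,
    add_comm]
  gcongr
  calc n = ∑ i ∈ Finset.Ico 0 n, 1 := by simp
    _ ≤ _ := Finset.sum_le_sum fun i hi => hpos i (by rw [Finset.mem_Ico] at hi; omega)

theorem map_linProd_mul {S : Type*} [CommRing S] (f : ℂ →+* S) (l : List ℂ) :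
    PowerSeries.map f (linProd (l : Multiset ℂ)) * PowerSeries.map f (hSer l) = 1 := by
  rw [← map_mul, linProd_mul_hSer, map_one]

theorem mRem_add_le (d ℓ : ℕ) (lam : ℕ → ℕ) (h : IsPartitionOf d ℓ lam) (n : ℕ) (hn : n ≤ d) :
    mRem ℓ lam n ≤ d - n := by
  by_cases hnl : n ≤ ℓ
  · have := mRem_le d ℓ lam h n hnl; omega
  · rw [mRem, Finset.Ico_eq_empty (by omega)]; simp

theorem bd_tan (d ℓ : ℕ) (lam : ℕ → ℕ) (h : IsPartitionOf d ℓ lam) (a : ℕ → ℂ) (n : ℕ)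
    (hn : n ≤ d) (J : Finset (Fin d)) (hJ : J.card = d - n) :
    Bd (tanIdeal d ℓ lam a)
      (PowerSeries.map C (hSer (aTuple ℓ lam a n)) * eSer d J) (d - n - mRem ℓ lam n) := by
  by_cases hnl : n < ℓ
  · refine bd_of_window _ _ (PowerSeries.map C (linProd (aTuple ℓ lam a n : List ℂ))) _ _
      (mRem_add_le d ℓ lam h n hn) ?_ ?_ ?_ ?_
    · rw [PowerSeries.coeff_map, coeff_zero_linProd, map_one]
    · rw [← card_aTuple ℓ lam a n]
      exact (bd_linProd _).map _ (by intro x hx; rw [Ideal.mem_bot] at hx; simp [hx])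
    · rw [mul_right_comm, mul_comm (PowerSeries.map C (hSer _)), map_linProd_mul, one_mul, ← hJ]
      exact bd_eSer _ _ _
    · intro r h1 h2
      rw [← tanGen_eq]
      exact Ideal.subset_span ⟨n, J, r, hnl, hJ, h1, h2, rfl⟩
  · have h1 : aTuple ℓ lam a n = [] := by
      unfold aTuple
      rw [List.drop_eq_nil_of_le (by simp; omega)]; rfl
    have h2 : mRem ℓ lam n = 0 := by
      rw [mRem, Finset.Ico_eq_empty (by omega)]; simp
    rw [h1, h2, hSer_nil, map_one, one_mul, Nat.sub_zero, ← hJ]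
    exact bd_eSer _ _ _

open TensorProduct in
theorem kappa_castAdd (d₁ d₂ : ℕ) (i : Fin d₁) :
    kappa d₁ d₂ (X (Fin.castAdd d₂ i)) = X i ⊗ₜ[ℂ] (1 : MvPolynomial (Fin d₂) ℂ) := by
  simp [kappa]

open TensorProduct in
theorem kappa_natAdd (d₁ d₂ : ℕ) (i : Fin d₂) :
    kappa d₁ d₂ (X (Fin.natAdd d₁ i)) = (1 : MvPolynomial (Fin d₁) ℂ) ⊗ₜ[ℂ] X i := by
  simp [kappa]

theorem kappa_surjective (d₁ d₂ : ℕ) : Function.Surjective (kappa d₁ d₂) := by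
  have h1 : (kappa d₁ d₂).comp (rename (Fin.castAdd d₂)) =
      (Algebra.TensorProduct.includeLeft : MvPolynomial (Fin d₁) ℂ →ₐ[ℂ]
        TensorProduct ℂ (MvPolynomial (Fin d₁) ℂ) (MvPolynomial (Fin d₂) ℂ)) := by
    apply algHom_ext
    intro i
    simp [kappa_castAdd]
  have h2 : (kappa d₁ d₂).comp (rename (Fin.natAdd d₁)) =
      (Algebra.TensorProduct.includeRight : MvPolynomial (Fin d₂) ℂ →ₐ[ℂ]
        TensorProduct ℂ (MvPolynomial (Fin d₁) ℂ) (MvPolynomial (Fin d₂) ℂ)) := by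
    apply algHom_ext
    intro i
    simp [kappa_natAdd]
  intro z
  induction z using TensorProduct.induction_on with
  | zero => exact ⟨0, map_zero _⟩
  | tmul x y =>
    refine ⟨rename (Fin.castAdd d₂) x * rename (Fin.natAdd d₁) y, ?_⟩
    have e1 := DFunLike.congr_fun h1 x
    have e2 := DFunLike.congr_fun h2 y
    simp only [AlgHom.comp_apply] at e1 e2
    rw [map_mul, e1, e2]
    simp
  | add x y hx hy =>
    obtain ⟨x', rfl⟩ := hx
    obtain ⟨y', rfl⟩ := hy
    exact ⟨x' + y', map_add _ _ _⟩

/-- First part of a subset of `Fin (d₁ + d₂)`. -/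
def leftPart {d₁ d₂ : ℕ} (J : Finset (Fin (d₁ + d₂))) : Finset (Fin d₁) :=
  Finset.univ.filter fun i => Fin.castAdd d₂ i ∈ J

/-- Second part of a subset of `Fin (d₁ + d₂)`. -/
def rightPart {d₁ d₂ : ℕ} (J : Finset (Fin (d₁ + d₂))) : Finset (Fin d₂) :=
  Finset.univ.filter fun i => Fin.natAdd d₁ i ∈ J

theorem card_parts {d₁ d₂ : ℕ} (J : Finset (Fin (d₁ + d₂))) :
    J.card = (leftPart J).card + (rightPart J).card := by
  have h : J = Finset.univ.filter fun i => i ∈ J := by ext; simp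
  conv_lhs => rw [h]
  simp only [leftPart, rightPart, Finset.card_filter]
  rw [Fin.sum_univ_add]

theorem map_kappa_eSer {d₁ d₂ : ℕ} (J : Finset (Fin (d₁ + d₂))) :
    PowerSeries.map (kappa d₁ d₂ : MvPolynomial (Fin (d₁ + d₂)) ℂ →+*
        TensorProduct ℂ (MvPolynomial (Fin d₁) ℂ) (MvPolynomial (Fin d₂) ℂ))
        (eSer (d₁ + d₂) J) =
      PowerSeries.map ((Algebra.TensorProduct.includeLeft : MvPolynomial (Fin d₁) ℂ →ₐ[ℂ]
        TensorProduct ℂ (MvPolynomial (Fin d₁) ℂ) (MvPolynomial (Fin d₂) ℂ)) :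
        MvPolynomial (Fin d₁) ℂ →+* _) (eSer d₁ (leftPart J)) *
      PowerSeries.map ((Algebra.TensorProduct.includeRight : MvPolynomial (Fin d₂) ℂ →ₐ[ℂ]
        TensorProduct ℂ (MvPolynomial (Fin d₁) ℂ) (MvPolynomial (Fin d₂) ℂ)) :
        MvPolynomial (Fin d₂) ℂ →+* _) (eSer d₂ (rightPart J)) := by
  have h : J = Finset.univ.filter fun i => i ∈ J := by ext; simp
  have h0 : eSer (d₁ + d₂) J = ∏ i, if i ∈ J then
      (1 + PowerSeries.C (X i) * PowerSeries.X) else 1 := by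
    rw [← Finset.prod_filter, ← h, eSer]
  rw [h0, Fin.prod_univ_add, map_mul]
  simp only [eSer, leftPart, rightPart, Finset.prod_filter, map_prod]
  congr 1
  · refine Finset.prod_congr rfl fun i _ => ?_
    split_ifs
    · simp [kappa_castAdd]
    · simp
  · refine Finset.prod_congr rfl fun i _ => ?_
    split_ifs
    · simp [kappa_natAdd]
    · simp

theorem kappa_mem (d₁ d₂ ℓ₁ ℓ₂ ℓν : ℕ) (lam mu nu : ℕ → ℕ)
    (hlam : IsPartitionOf d₁ ℓ₁ lam) (hmu : IsPartitionOf d₂ ℓ₂ mu)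
    (hnu : IsPartitionOf (d₁ + d₂) ℓν nu)
    (a b c : ℕ → ℂ) (τ : Fin (nu 0) ≃ (Fin (lam 0) ⊕ Fin (mu 0)))
    (hτ : ∀ i : Fin (nu 0), lamT ℓν nu (i.1 + 1) =
      Sum.elim (fun j : Fin (lam 0) => lamT ℓ₁ lam (j.1 + 1))
        (fun j : Fin (mu 0) => lamT ℓ₂ mu (j.1 + 1)) (τ i))
    (hc : ∀ i : Fin (nu 0), c i.1 =
      Sum.elim (fun j : Fin (lam 0) => a j.1) (fun j : Fin (mu 0) => b j.1) (τ i))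
    (K : Ideal (TensorProduct ℂ (MvPolynomial (Fin d₁) ℂ) (MvPolynomial (Fin d₂) ℂ)))
    (hK1 : ∀ x ∈ tanIdeal d₁ ℓ₁ lam a, (Algebra.TensorProduct.includeLeft :
            MvPolynomial (Fin d₁) ℂ →ₐ[ℂ]
              TensorProduct ℂ (MvPolynomial (Fin d₁) ℂ) (MvPolynomial (Fin d₂) ℂ)) x ∈ K)
    (hK2 : ∀ x ∈ tanIdeal d₂ ℓ₂ mu b, (Algebra.TensorProduct.includeRight :
            MvPolynomial (Fin d₂) ℂ →ₐ[ℂ]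
              TensorProduct ℂ (MvPolynomial (Fin d₁) ℂ) (MvPolynomial (Fin d₂) ℂ)) x ∈ K)
    (f : MvPolynomial (Fin (d₁ + d₂)) ℂ) (hf : f ∈ tanIdeal (d₁ + d₂) ℓν nu c) :
    kappa d₁ d₂ f ∈ K := by
  suffices hle : tanIdeal (d₁ + d₂) ℓν nu c ≤ K.comap (kappa d₁ d₂) from hle hf
  unfold tanIdeal
  rw [Ideal.span_le]
  rintro g ⟨n, J, r, hn, hJ, hr1, hr2, rfl⟩
  show kappa d₁ d₂ _ ∈ K
  have hnd : n ≤ d₁ + d₂ := by have := mRem_le _ _ _ hnu n hn.le; omega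
  have hc1 : (leftPart J).card ≤ d₁ := by simpa using Finset.card_le_univ (leftPart J)
  have hc2 : (rightPart J).card ≤ d₂ := by simpa using Finset.card_le_univ (rightPart J)
  have hcard := card_parts J
  obtain ⟨n₁, hn1⟩ : ∃ n₁, n₁ = d₁ - (leftPart J).card := ⟨_, rfl⟩
  obtain ⟨n₂, hn2⟩ : ∃ n₂, n₂ = d₂ - (rightPart J).card := ⟨_, rfl⟩
  have b1 := bd_tan d₁ ℓ₁ lam hlam a n₁ (by omega) (leftPart J) (by omega)
  have b2 := bd_tan d₂ ℓ₂ mu hmu b n₂ (by omega) (rightPart J) (by omega)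
  have hm1 := mRem_add_le d₁ ℓ₁ lam hlam n₁ (by omega)
  have hm2 := mRem_add_le d₂ ℓ₂ mu hmu n₂ (by omega)
  have hm := mRem_add_le _ ℓν nu hnu n hnd
  -- multiset comparison
  have hle : ((aTuple ℓν nu c n : List ℂ) : Multiset ℂ) ≤
      ((aTuple ℓ₁ lam a n₁ : List ℂ) : Multiset ℂ) +
        ((aTuple ℓ₂ mu b n₂ : List ℂ) : Multiset ℂ) := by
    rw [aTuple_eq' _ _ _ hlam, aTuple_eq' _ _ _ hmu, aTuple_eq' _ _ _ hnu]
    have : ∀ i : Fin (nu 0), (lamT ℓν nu (i.1 + 1) - n) • ({c i.1} : Multiset ℂ) =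
        (fun s : Fin (lam 0) ⊕ Fin (mu 0) =>
          (Sum.elim (fun j : Fin (lam 0) => lamT ℓ₁ lam (j.1 + 1))
            (fun j : Fin (mu 0) => lamT ℓ₂ mu (j.1 + 1)) s - n) •
          ({Sum.elim (fun j : Fin (lam 0) => a j.1) (fun j : Fin (mu 0) => b j.1) s} :
            Multiset ℂ)) (τ i) := by
      intro i; rw [hτ, hc]
    rw [Finset.sum_congr rfl fun i _ => this i, Equiv.sum_comp τ (fun s : Fin (lam 0) ⊕ Fin (mu 0) =>
          (Sum.elim (fun j : Fin (lam 0) => lamT ℓ₁ lam (j.1 + 1))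
            (fun j : Fin (mu 0) => lamT ℓ₂ mu (j.1 + 1)) s - n) •
          ({Sum.elim (fun j : Fin (lam 0) => a j.1) (fun j : Fin (mu 0) => b j.1) s} :
            Multiset ℂ)), Fintype.sum_sum_type]
    simp only [Sum.elim_inl, Sum.elim_inr]
    refine add_le_add (Finset.sum_le_sum fun i _ => ?_) (Finset.sum_le_sum fun i _ => ?_)
    · exact nsmul_le_nsmul_left (Multiset.zero_le _) (by omega)
    · exact nsmul_le_nsmul_left (Multiset.zero_le _) (by omega)
  obtain ⟨Q, hQ⟩ := Multiset.le_iff_exists_add.mp hle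
  have hQc := congrArg Multiset.card hQ
  rw [Multiset.card_add, Multiset.card_add, card_aTuple, card_aTuple, card_aTuple] at hQc
  have hprod : linProd (aTuple ℓ₁ lam a n₁ : List ℂ) * linProd (aTuple ℓ₂ mu b n₂ : List ℂ) =
      linProd (aTuple ℓν nu c n : List ℂ) * linProd Q := by
    have := congrArg linProd hQ
    simpa only [linProd, Multiset.map_add, Multiset.prod_add] using this
  have e1 := linProd_mul_hSer (aTuple ℓ₁ lam a n₁)
  have e2 := linProd_mul_hSer (aTuple ℓ₂ mu b n₂)
  have e3 := linProd_mul_hSer (aTuple ℓν nu c n)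
  have hH : hSer (aTuple ℓν nu c n) =
      hSer (aTuple ℓ₁ lam a n₁) * hSer (aTuple ℓ₂ mu b n₂) * linProd Q := by
    generalize hSer (aTuple ℓν nu c n) = H at *
    generalize hSer (aTuple ℓ₁ lam a n₁) = H1 at *
    generalize hSer (aTuple ℓ₂ mu b n₂) = H2 at *
    generalize linProd (aTuple ℓν nu c n : List ℂ) = A at *
    generalize linProd (aTuple ℓ₁ lam a n₁ : List ℂ) = A1 at *
    generalize linProd (aTuple ℓ₂ mu b n₂ : List ℂ) = A2 at *
    generalize linProd Q = B at *
    linear_combination (-H * A2 * H2) * e1 - H * e2 + H1 * H2 * B * e3 + H * H1 * H2 * hprod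
  have bQ : Bd K (PowerSeries.map (algebraMap ℂ _) (linProd Q)) Q.card :=
    (bd_linProd Q).map _ (by intro x hx; rw [Ideal.mem_bot] at hx; simp [hx])
  have b1' := b1.map (K := K) (Algebra.TensorProduct.includeLeft :
            MvPolynomial (Fin d₁) ℂ →ₐ[ℂ]
              TensorProduct ℂ (MvPolynomial (Fin d₁) ℂ) (MvPolynomial (Fin d₂) ℂ)).toRingHom hK1
  have b2' := b2.map (K := K) (Algebra.TensorProduct.includeRight :
            MvPolynomial (Fin d₂) ℂ →ₐ[ℂ]
              TensorProduct ℂ (MvPolynomial (Fin d₁) ℂ) (MvPolynomial (Fin d₂) ℂ)).toRingHom hK2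
  have hall := (b1'.mul b2').mul bQ
  have hfin := hall r (by omega)
  rw [tanGen_eq]
  have hcm := PowerSeries.coeff_map (kappa d₁ d₂ : MvPolynomial (Fin (d₁ + d₂)) ℂ →+*
        TensorProduct ℂ (MvPolynomial (Fin d₁) ℂ) (MvPolynomial (Fin d₂) ℂ)) r
        (PowerSeries.map C (hSer (aTuple ℓν nu c n)) * eSer (d₁ + d₂) J)
  change _ = kappa d₁ d₂ _ at hcm
  rw [← hcm, map_mul, map_kappa_eSer, hH]
  convert hfin using 2
  have hmm : ∀ {d : ℕ} (φ : MvPolynomial (Fin d) ℂ →ₐ[ℂ]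
      TensorProduct ℂ (MvPolynomial (Fin d₁) ℂ) (MvPolynomial (Fin d₂) ℂ)) (P : PowerSeries ℂ),
      PowerSeries.map (φ : MvPolynomial (Fin d) ℂ →+*
        TensorProduct ℂ (MvPolynomial (Fin d₁) ℂ) (MvPolynomial (Fin d₂) ℂ)) (PowerSeries.map C P) =
        PowerSeries.map (algebraMap ℂ _) P := by
    intro d φ P
    ext k
    simp only [PowerSeries.coeff_map]
    exact φ.commutes _
  have hmm1 := hmm (Algebra.TensorProduct.includeLeft :
            MvPolynomial (Fin d₁) ℂ →ₐ[ℂ]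
              TensorProduct ℂ (MvPolynomial (Fin d₁) ℂ) (MvPolynomial (Fin d₂) ℂ))
  have hmm2 := hmm (Algebra.TensorProduct.includeRight :
            MvPolynomial (Fin d₂) ℂ →ₐ[ℂ]
              TensorProduct ℂ (MvPolynomial (Fin d₁) ℂ) (MvPolynomial (Fin d₂) ℂ))
  rw [hmm, AlgHom.toRingHom_eq_coe, AlgHom.toRingHom_eq_coe,
    map_mul (PowerSeries.map (RingHomClass.toRingHom Algebra.TensorProduct.includeLeft)),
    map_mul (PowerSeries.map (RingHomClass.toRingHom Algebra.TensorProduct.includeRight)),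
    hmm1, hmm2, map_mul, map_mul]
  ring

/-- `κ` maps the deformed Tanisaki ideal of the concatenation `(ν,c)` of
`(λ,a)` and `(μ,b)` into `⟨𝒞^a_λ⟩ ⊗ ℂ[t] + ℂ[t] ⊗ ⟨𝒞^b_μ⟩`, and hence induces a surjective
algebra homomorphism `R_c(ν) → R_a(λ) ⊗ R_b(μ)`. -/
theorem deformed_TGP_concatenation (d₁ d₂ ℓ₁ ℓ₂ ℓν : ℕ) (lam mu nu : ℕ → ℕ)
    (hlam : IsPartitionOf d₁ ℓ₁ lam) (hmu : IsPartitionOf d₂ ℓ₂ mu)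
    (hnu : IsPartitionOf (d₁ + d₂) ℓν nu)
    (a b c : ℕ → ℂ) (τ : Fin (nu 0) ≃ (Fin (lam 0) ⊕ Fin (mu 0)))
    (hτ : ∀ i : Fin (nu 0), lamT ℓν nu (i.1 + 1) =
      Sum.elim (fun j : Fin (lam 0) => lamT ℓ₁ lam (j.1 + 1))
        (fun j : Fin (mu 0) => lamT ℓ₂ mu (j.1 + 1)) (τ i))
    (hc : ∀ i : Fin (nu 0), c i.1 =
      Sum.elim (fun j : Fin (lam 0) => a j.1) (fun j : Fin (mu 0) => b j.1) (τ i)) :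
    (∀ f ∈ tanIdeal (d₁ + d₂) ℓν nu c,
      kappa d₁ d₂ f ∈
        Ideal.map (Algebra.TensorProduct.includeLeft :
            MvPolynomial (Fin d₁) ℂ →ₐ[ℂ]
              TensorProduct ℂ (MvPolynomial (Fin d₁) ℂ) (MvPolynomial (Fin d₂) ℂ))
          (tanIdeal d₁ ℓ₁ lam a) ⊔
        Ideal.map (Algebra.TensorProduct.includeRight :
            MvPolynomial (Fin d₂) ℂ →ₐ[ℂ]
              TensorProduct ℂ (MvPolynomial (Fin d₁) ℂ) (MvPolynomial (Fin d₂) ℂ))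
          (tanIdeal d₂ ℓ₂ mu b)) ∧
    ∃ ψ : TGPAlg (d₁ + d₂) ℓν nu c →ₐ[ℂ]
        TensorProduct ℂ (TGPAlg d₁ ℓ₁ lam a) (TGPAlg d₂ ℓ₂ mu b),
      Function.Surjective ψ ∧
      ∀ f : MvPolynomial (Fin (d₁ + d₂)) ℂ,
        ψ (Ideal.Quotient.mk (tanIdeal (d₁ + d₂) ℓν nu c) f) =
          Algebra.TensorProduct.map
            (Ideal.Quotient.mkₐ ℂ (tanIdeal d₁ ℓ₁ lam a))
            (Ideal.Quotient.mkₐ ℂ (tanIdeal d₂ ℓ₂ mu b)) (kappa d₁ d₂ f) := by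
  have key := kappa_mem d₁ d₂ ℓ₁ ℓ₂ ℓν lam mu nu hlam hmu hnu a b c τ hτ hc
  refine ⟨fun f hf => key _ (fun x hx => ?_) (fun x hx => ?_) f hf, ?_⟩
  · exact Ideal.mem_sup_left (Ideal.mem_map_of_mem _ hx)
  · exact Ideal.mem_sup_right (Ideal.mem_map_of_mem _ hx)
  · have hker : ∀ f ∈ tanIdeal (d₁ + d₂) ℓν nu c,
        ((Algebra.TensorProduct.map
            (Ideal.Quotient.mkₐ ℂ (tanIdeal d₁ ℓ₁ lam a))
            (Ideal.Quotient.mkₐ ℂ (tanIdeal d₂ ℓ₂ mu b))).comp (kappa d₁ d₂)) f = 0 := by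
      intro f hf
      have := key (RingHom.ker (Algebra.TensorProduct.map
            (Ideal.Quotient.mkₐ ℂ (tanIdeal d₁ ℓ₁ lam a))
            (Ideal.Quotient.mkₐ ℂ (tanIdeal d₂ ℓ₂ mu b)))) (fun x hx => ?_) (fun x hx => ?_) f hf
      · exact this
      · rw [RingHom.mem_ker, Algebra.TensorProduct.includeLeft_apply,
          Algebra.TensorProduct.map_tmul, Ideal.Quotient.mkₐ_eq_mk,
          Ideal.Quotient.eq_zero_iff_mem.mpr hx, TensorProduct.zero_tmul]
      · rw [RingHom.mem_ker, Algebra.TensorProduct.includeRight_apply,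
          Algebra.TensorProduct.map_tmul, Ideal.Quotient.mkₐ_eq_mk, Ideal.Quotient.mkₐ_eq_mk,
          Ideal.Quotient.eq_zero_iff_mem.mpr hx, TensorProduct.tmul_zero]
    refine ⟨Ideal.Quotient.liftₐ _ _ hker, ?_, fun f => rfl⟩
    have hs : Function.Surjective ((Algebra.TensorProduct.map
            (Ideal.Quotient.mkₐ ℂ (tanIdeal d₁ ℓ₁ lam a))
            (Ideal.Quotient.mkₐ ℂ (tanIdeal d₂ ℓ₂ mu b))).comp (kappa d₁ d₂)) := by
      rw [AlgHom.coe_comp]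
      refine Function.Surjective.comp ?_ (kappa_surjective d₁ d₂)
      exact TensorProduct.map_surjective (Ideal.Quotient.mkₐ_surjective ℂ _)
        (Ideal.Quotient.mkₐ_surjective ℂ _)
    intro z
    obtain ⟨f, hf⟩ := hs z
    exact ⟨Ideal.Quotient.mk _ f, hf⟩

end
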